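/- arXiv:2411.19415 — 5 statements merged into one kernel-verified Lean document; each statement's English description precedes it below -/
import Mathlib

section
/- Fix t ∈ (0,1) and c ≥ 0. For ε > 0 small enough that o(ε) = t + (1+c)ε ≤ 1, set s(ε) = t + ε and b(ε)² = (1−s(ε))² − s(ε)²·(1−o(ε))²/o(ε)². Then the limit as ε → 0⁺ of b(ε)²/ε equals 2c(1−t)/t. -/
open Filter Set

/-- **Squared diffusion coefficient `2c(1−t)/t` in the SDE limit of the overshooting
sampler.** Fix `t ∈ (0,1)` and `c ≥ 0`. With `s(ε) = t + ε`, `o(ε) = t + (1+c)ε`, and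
`b(ε)² = (1−s(ε))² − s(ε)²(1−o(ε))²/o(ε)²`, the limit as `ε → 0⁺` of `b(ε)²/ε`
equals `2c(1−t)/t`. -/
theorem overshooting_b_squared_limit
    (t c : ℝ) (ht : t ∈ Set.Ioo (0 : ℝ) 1) (hc : 0 ≤ c) :
    Tendsto
      (fun ε : ℝ =>
        ((1 - (t + ε)) ^ 2 - (t + ε) ^ 2 * (1 - (t + (1 + c) * ε)) ^ 2
            / (t + (1 + c) * ε) ^ 2) / ε)
      (nhdsWithin 0 (Set.Ioi 0)) (nhds (2 * c * (1 - t) / t)) := by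
  obtain ⟨ht0, ht1⟩ := ht
  have hcont : ContinuousAt (fun ε : ℝ =>
      c * ((t + (1 + c) * ε) + (t + ε) - 2 * (t + ε) * (t + (1 + c) * ε))
        / (t + (1 + c) * ε) ^ 2) 0 := by
    refine ContinuousAt.div (by fun_prop) (by fun_prop) ?_
    simpa using ht0.ne'
  have hlim := hcont.tendsto.mono_left (nhdsWithin_le_nhds (s := Set.Ioi (0 : ℝ)))
  have hval : c * ((t + (1 + c) * 0) + (t + 0) - 2 * (t + 0) * (t + (1 + c) * 0))
      / (t + (1 + c) * 0) ^ 2 = 2 * c * (1 - t) / t := by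
    simp only [mul_zero, add_zero]
    field_simp
    ring
  rw [hval] at hlim
  refine hlim.congr' ?_
  filter_upwards [self_mem_nhdsWithin] with ε (hε : 0 < ε)
  have ho : t + (1 + c) * ε ≠ 0 := by positivity
  field_simp
  ring
end

section
/- Fix t ∈ (0,1) and c ≥ 0. For ε > 0 small enough that o(ε) = t + (1+c)ε ≤ 1, set s(ε) = t + ε and b(ε) = √((1−s(ε))² − s(ε)²(1−o(ε))²/o(ε)²). Then the limit as ε → 0⁺ of b(ε)/√ε equals √(2c(1−t)/t). -/
open Filter Set

/-- **Diffusion coefficient `√(2c(1−t)/t)` in the SDE limit of the overshooting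
sampler.** Fix `t ∈ (0,1)` and `c ≥ 0`. With `s(ε) = t + ε`, `o(ε) = t + (1+c)ε`, and
`b(ε) = √((1−s(ε))² − s(ε)²(1−o(ε))²/o(ε)²)`, the limit as `ε → 0⁺` of `b(ε)/√ε`
equals `√(2c(1−t)/t)`. -/
theorem overshooting_b_over_sqrt_eps_limit
    (t c : ℝ) (ht : t ∈ Set.Ioo (0 : ℝ) 1) (hc : 0 ≤ c) :
    Tendsto
      (fun ε : ℝ =>
        Real.sqrt ((1 - (t + ε)) ^ 2 - (t + ε) ^ 2 * (1 - (t + (1 + c) * ε)) ^ 2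
            / (t + (1 + c) * ε) ^ 2) / Real.sqrt ε)
      (nhdsWithin 0 (Set.Ioi 0)) (nhds (Real.sqrt (2 * c * (1 - t) / t))) := by
  obtain ⟨ht0, ht1⟩ := ht
  have hcont : ContinuousAt (fun ε : ℝ => Real.sqrt
      (c * ((t + (1 + c) * ε) + (t + ε) - 2 * (t + ε) * (t + (1 + c) * ε))
        / (t + (1 + c) * ε) ^ 2)) 0 := by
    refine ContinuousAt.sqrt (ContinuousAt.div (by fun_prop) (by fun_prop) ?_)
    simpa using ht0.ne'
  have hlim := hcont.tendsto.mono_left (nhdsWithin_le_nhds (s := Set.Ioi 0))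
  have hval : c * ((t + (1 + c) * 0) + (t + 0) - 2 * (t + 0) * (t + (1 + c) * 0))
      / (t + (1 + c) * 0) ^ 2 = 2 * c * (1 - t) / t := by
    simp only [mul_zero, add_zero]
    field_simp
    ring
  rw [hval] at hlim
  refine hlim.congr' ?_
  filter_upwards [self_mem_nhdsWithin] with ε hε
  have hε0 : 0 < ε := hε
  have ho : 0 < t + (1 + c) * ε := by positivity
  rw [← Real.sqrt_div' _ hε0.le]
  congr 1
  generalize hov : t + (1 + c) * ε = o at ho ⊢
  have hdiff : o - (t + ε) = c * ε := by rw [← hov]; ring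
  rw [eq_div_iff hε0.ne']
  calc c * (o + (t + ε) - 2 * (t + ε) * o) / o ^ 2 * ε
      = (o - (t + ε)) * (o + (t + ε) - 2 * (t + ε) * o) / o ^ 2 := by rw [hdiff]; ring
    _ = (1 - (t + ε)) ^ 2 - (t + ε) ^ 2 * (1 - o) ^ 2 / o ^ 2 := by
      field_simp
      ring
end

section
/- Fix t ∈ (0,1], c ≥ 0, and vectors z, v ∈ ℝ^d. For ε > 0 set s(ε) = t + ε, o(ε) = t + (1+c)ε, and a(ε) = s(ε)/o(ε). Then the limit as ε → 0⁺ of (1/ε)·(a(ε)·z + a(ε)·(o(ε) − t)·v − z) in ℝ^d equals (1+c)·v − (c/t)·z. -/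
open Filter Set

/-- **Adjusted drift of the limiting SDE of the overshooting sampler.**
Fix `t ∈ (0,1]`, `c ≥ 0`, and vectors `z, v ∈ ℝ^d`. With `s(ε) = t + ε`,
`o(ε) = t + (1+c)ε`, and `a(ε) = s(ε)/o(ε)`, the limit as `ε → 0⁺` of
`(1/ε)·(a(ε)·z + a(ε)·(o(ε) − t)·v − z)` equals `(1+c)·v − (c/t)·z`. -/
theorem overshooting_adjusted_drift_limit
    {d : ℕ} (t c : ℝ) (ht : t ∈ Set.Ioc (0 : ℝ) 1) (hc : 0 ≤ c)
    (z v : EuclideanSpace ℝ (Fin d)) :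
    Tendsto
      (fun ε : ℝ =>
        (1 / ε) • (((t + ε) / (t + (1 + c) * ε)) • z
          + ((t + ε) / (t + (1 + c) * ε) * ((t + (1 + c) * ε) - t)) • v - z))
      (nhdsWithin 0 (Set.Ioi 0)) (nhds ((1 + c) • v - (c / t) • z)) := by
  have ht0 : 0 < t := ht.1
  have overshoot_tendsto :
      Tendsto (fun ε : ℝ => t + (1 + c) * ε) (nhdsWithin 0 (Set.Ioi 0)) (nhds t) := by
    have h : Continuous fun ε : ℝ => t + (1 + c) * ε := by fun_prop
    simpa using (h.tendsto 0).mono_left nhdsWithin_le_nhds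
  have target_tendsto : Tendsto (fun ε : ℝ => t + ε) (nhdsWithin 0 (Set.Ioi 0)) (nhds t) := by
    have h : Continuous fun ε : ℝ => t + ε := by fun_prop
    simpa using (h.tendsto 0).mono_left nhdsWithin_le_nhds
  have drift_tendsto :
      Tendsto
        (fun ε : ℝ => ((t + ε) / (t + (1 + c) * ε) * (1 + c)) • v - (c / (t + (1 + c) * ε)) • z)
        (nhdsWithin 0 (Set.Ioi 0)) (nhds ((1 + c) • v - (c / t) • z)) := by
    have h := (((target_tendsto.div overshoot_tendsto ht0.ne').mul_const (1 + c)).smul_const v).sub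
      (((tendsto_const_nhds (x := c)).div overshoot_tendsto ht0.ne').smul_const z)
    simpa [div_self ht0.ne'] using h
  refine drift_tendsto.congr' ?_
  filter_upwards [self_mem_nhdsWithin] with ε hε
  have hε0 : 0 < ε := hε
  have ho : t + (1 + c) * ε ≠ 0 := by positivity
  match_scalars
  · field_simp
    ring
  · field_simp
    ring
end

section
/- Let d ≥ 1 and let Y and Z be independent ℝ^d-valued random variables on a probability space, where Y has a strictly positive differentiable density ρ_Y with respect to Lebesgue measure on ℝ^d. Suppose X = Y + Z has a density ρ_X that is strictly positive and differentiable, and that differentiation under the expectation is valid: ∇ρ_X(x) = 𝔼[∇ρ_Y(x − Z)] for every x ∈ ℝ^d. Assume moreover that ∇log ρ_Y(Y) = ∇ρ_Y(Y)/ρ_Y(Y) is integrable. Then the conditional expectation of ∇log ρ_Y(Y) given the σ-algebra generated by X equals (∇log ρ_X)(X) almost surely, i.e. 𝔼[∇(log∘ρ_Y)(Y) ∣ σ(X)] = ∇(log∘ρ_X)(X) a.s. -/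
open MeasureTheory ProbabilityTheory

section Gradient

variable {F : Type*} [NormedAddCommGroup F] [InnerProductSpace ℝ F] [CompleteSpace F]

lemma smul_gradient_log_comp {ρ : F → ℝ} {x : F} (hpos : 0 < ρ x)
    (hdiff : DifferentiableAt ℝ ρ x) :
    ρ x • gradient (Real.log ∘ ρ) x = gradient ρ x := by
  have h : fderiv ℝ (Real.log ∘ ρ) x = (ρ x)⁻¹ • fderiv ℝ ρ x :=
    (hdiff.hasFDerivAt.log hpos.ne').fderiv
  simp only [gradient, h, map_smulₛₗ, smul_smul]
  simp [hpos.ne']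

lemma measurable_gradient [MeasurableSpace F] [BorelSpace F] (f : F → ℝ) :
    Measurable (gradient f) :=
  (InnerProductSpace.toDual ℝ F).symm.continuous.measurable.comp (measurable_fderiv ℝ f)

end Gradient

section Density

variable {E G : Type*} [MeasurableSpace E] [NormedAddCommGroup G] [NormedSpace ℝ G]
  {μ : Measure E} {ρ : E → ℝ}

lemma integrable_withDensity_ofReal_iff (hρ : Measurable ρ) (hρ_nonneg : ∀ x, 0 ≤ ρ x)
    {f : E → G} :
    Integrable f (μ.withDensity fun x => ENNReal.ofReal (ρ x)) ↔
      Integrable (fun x => ρ x • f x) μ := by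
  rw [integrable_withDensity_iff_integrable_smul' hρ.ennreal_ofReal (by simp)]
  simp only [ENNReal.toReal_ofReal (hρ_nonneg _)]

lemma integral_withDensity_ofReal (hρ : Measurable ρ) (hρ_nonneg : ∀ x, 0 ≤ ρ x)
    (f : E → G) :
    ∫ x, f x ∂(μ.withDensity fun x => ENNReal.ofReal (ρ x)) = ∫ x, ρ x • f x ∂μ := by
  rw [integral_withDensity_eq_integral_toReal_smul hρ.ennreal_ofReal (by simp)]
  simp only [ENNReal.toReal_ofReal (hρ_nonneg _)]

end Density

section Translation

variable {E G : Type*} [MeasurableSpace E] [AddGroup E] [MeasurableAdd₂ E] [MeasurableNeg E]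
  [NormedAddCommGroup G] {μ ν : Measure E} [SFinite μ] [μ.IsAddRightInvariant] [IsFiniteMeasure ν]

lemma integrable_comp_sub_prod {g : E → G} (hg : StronglyMeasurable g) (hgi : Integrable g μ) :
    Integrable (fun p : E × E => g (p.1 - p.2)) (μ.prod ν) := by
  have hm : StronglyMeasurable fun p : E × E => g (p.1 - p.2) :=
    hg.comp_measurable (measurable_fst.sub measurable_snd)
  rw [integrable_prod_iff' hm.aestronglyMeasurable]
  refine ⟨.of_forall fun z => hgi.comp_sub_right z, ?_⟩
  have h (z : E) : ∫ x, ‖g (x - z)‖ ∂μ = ∫ x, ‖g x‖ ∂μ :=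
    integral_sub_right_eq_self (fun x => ‖g x‖) z
  simp only [h]
  exact integrable_const _

end Translation

/-- **Score of a sum of independent random variables as a conditional expectation.**
Let `Y` and `Z` be independent `ℝ^d`-valued random variables, `Y` having a strictly
positive differentiable density `ρY` with respect to Lebesgue measure. Suppose
`X = Y + Z` has a strictly positive differentiable density `ρX`, and differentiation
under the expectation is valid: `∇ρX(x) = 𝔼[∇ρY(x − Z)]` for every `x`. If the score
`∇log ρY (Y)` is integrable, then `𝔼[∇(log∘ρY)(Y) ∣ σ(X)] = ∇(log∘ρX)(X)` a.s. -/
theorem score_sum_eq_condexp_score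
    {d : ℕ} (hd : 1 ≤ d)
    {Ω : Type*} [MeasureSpace Ω] [IsProbabilityMeasure (ℙ : Measure Ω)]
    (Y Z : Ω → EuclideanSpace ℝ (Fin d))
    (hY : Measurable Y) (hZ : Measurable Z)
    (hindep : IndepFun Y Z ℙ)
    (ρY : EuclideanSpace ℝ (Fin d) → ℝ)
    (hρY_pos : ∀ x, 0 < ρY x) (hρY_diff : Differentiable ℝ ρY)
    (hY_law : Measure.map Y ℙ = volume.withDensity fun x => ENNReal.ofReal (ρY x))
    (X : Ω → EuclideanSpace ℝ (Fin d)) (hXdef : X = fun ω => Y ω + Z ω)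
    (ρX : EuclideanSpace ℝ (Fin d) → ℝ)
    (hρX_pos : ∀ x, 0 < ρX x) (hρX_diff : Differentiable ℝ ρX)
    (hX_law : Measure.map X ℙ = volume.withDensity fun x => ENNReal.ofReal (ρX x))
    (hder : ∀ x, gradient ρX x = ∫ ω, gradient ρY (x - Z ω) ∂ℙ)
    (hint : Integrable (fun ω => gradient (Real.log ∘ ρY) (Y ω)) ℙ) :
    ℙ[(fun ω => gradient (Real.log ∘ ρY) (Y ω)) |
        MeasurableSpace.comap X inferInstance]
      =ᵐ[ℙ] fun ω => gradient (Real.log ∘ ρX) (X ω) := by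
  have hρY := hρY_diff.continuous.measurable
  have hρX := hρX_diff.continuous.measurable
  have hX : Measurable X := hXdef ▸ hY.add hZ
  have hYs (x) := smul_gradient_log_comp (hρY_pos x) (hρY_diff x)
  have hXs (x) := smul_gradient_log_comp (hρX_pos x) (hρX_diff x)
  have hsY := (measurable_gradient (Real.log ∘ ρY)).stronglyMeasurable
  have hsX := (measurable_gradient (Real.log ∘ ρX)).stronglyMeasurable
  have hg := (measurable_gradient ρY).stronglyMeasurable
  set ν := Measure.map Z ℙ with hν
  have : IsProbabilityMeasure ν := Measure.isProbabilityMeasure_map hZ.aemeasurable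
  have : IsProbabilityMeasure (Measure.map Y ℙ) :=
    Measure.isProbabilityMeasure_map hY.aemeasurable
  have hder' (x) : gradient ρX x = ∫ z, gradient ρY (x - z) ∂ν := by
    rw [hder, hν, integral_map hZ.aemeasurable]
    exact (hg.comp_measurable (measurable_const.sub measurable_id)).aestronglyMeasurable
  have hsY_int : Integrable (gradient (Real.log ∘ ρY)) (Measure.map Y ℙ) :=
    (integrable_map_measure hsY.aestronglyMeasurable hY.aemeasurable).2 hint
  have hg_int : Integrable (gradient ρY) := by
    rw [hY_law, integrable_withDensity_ofReal_iff hρY fun x => (hρY_pos x).le] at hsY_int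
    simpa only [hYs] using hsY_int
  have hconv : Integrable (fun p : EuclideanSpace ℝ (Fin d) × EuclideanSpace ℝ (Fin d) =>
      gradient ρY (p.1 - p.2)) (volume.prod ν) := integrable_comp_sub_prod hg hg_int
  have hsX_int : Integrable (fun ω => gradient (Real.log ∘ ρX) (X ω)) ℙ := by
    refine (integrable_map_measure hsX.aestronglyMeasurable hX.aemeasurable).1 ?_
    rw [hX_law, integrable_withDensity_ofReal_iff hρX fun x => (hρX_pos x).le]
    simpa only [hXs, hder'] using hconv.integral_prod_left
  have hlaw : Measure.map (fun ω => (Y ω, Z ω)) ℙ = (Measure.map Y ℙ).prod ν :=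
    (indepFun_iff_map_prod_eq_prod_map_map hY.aemeasurable hZ.aemeasurable).1 hindep
  symm
  refine ae_eq_condExp_of_forall_setIntegral_eq hX.comap_le hint
    (fun _ _ _ => hsX_int.integrableOn) ?_
    (hsX.comp_measurable (comap_measurable X)).aestronglyMeasurable
  rintro _ ⟨A, hA, rfl⟩ -
  have hB : MeasurableSet {p : EuclideanSpace ℝ (Fin d) × EuclideanSpace ℝ (Fin d) |
      p.1 + p.2 ∈ A} := (measurable_fst.add measurable_snd) hA
  have hleft : ∫ ω in X ⁻¹' A, gradient (Real.log ∘ ρX) (X ω) ∂ℙ =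
      ∫ x, A.indicator (gradient ρX) x := by
    rw [← setIntegral_map hA hsX.aestronglyMeasurable hX.aemeasurable, ← integral_indicator hA,
      hX_law, integral_withDensity_ofReal hρX fun x => (hρX_pos x).le]
    simp only [← Set.indicator_smul_apply, hXs]
  have hright : ∫ ω in X ⁻¹' A, gradient (Real.log ∘ ρY) (Y ω) ∂ℙ =
      ∫ z, (∫ x, A.indicator (fun x => gradient ρY (x - z)) x) ∂ν := by
    have hpre : X ⁻¹' A = (fun ω => (Y ω, Z ω)) ⁻¹' {p | p.1 + p.2 ∈ A} := by
      rw [hXdef]; rfl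
    rw [hpre, ← setIntegral_map (f := fun p => gradient (Real.log ∘ ρY) p.1) hB
      (hsY.comp_measurable measurable_fst).aestronglyMeasurable (hY.prodMk hZ).aemeasurable,
      ← integral_indicator hB, hlaw,
      integral_prod_symm _ ((hsY_int.comp_fst ν).indicator hB)]
    refine integral_congr_ae (.of_forall fun z => ?_)
    dsimp only
    rw [hY_law, integral_withDensity_ofReal hρY fun x => (hρY_pos x).le,
      ← integral_sub_right_eq_self _ z]
    refine integral_congr_ae (.of_forall fun x => ?_)
    by_cases hx : x ∈ A <;> simp [Set.indicator, hx, hYs]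
  rw [hleft, hright, integral_integral_swap]
  · refine integral_congr_ae (.of_forall fun x => ?_)
    by_cases hx : x ∈ A <;> simp [hx, hder']
  · exact (hconv.indicator (measurable_fst hA)).swap
end

section
/- Let d ≥ 1. Let ρ : (0,1) × ℝ^d → ℝ be strictly positive, continuously differentiable in the time variable, and twice continuously differentiable in the space variable, and let v : (0,1) × ℝ^d → ℝ^d be continuously differentiable in the space variable. Suppose ρ satisfies the continuity equation ∂_t ρ(t,x) = −div_x(y ↦ v(t,y)·ρ(t,y))(x) for all (t,x) ∈ (0,1) × ℝ^d. Then for every function σ : (0,1) → ℝ, defining the adjusted drift f(t,x) = v(t,x) + (σ(t)²/2)·∇_x(log∘ρ(t,·))(x), ρ satisfies the Fokker–Planck equation ∂_t ρ(t,x) = −div_x(y ↦ f(t,y)·ρ(t,y))(x) + (σ(t)²/2)·Δ_x ρ(t,x) for all (t,x) ∈ (0,1) × ℝ^d. -/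
open MeasureTheory Set

/-- Divergence of a vector field on `ℝ^d`: the sum of the diagonal entries of its
(Fréchet) derivative, i.e. the trace of the derivative. -/
noncomputable def diverg {d : ℕ}
    (F : EuclideanSpace ℝ (Fin d) → EuclideanSpace ℝ (Fin d))
    (x : EuclideanSpace ℝ (Fin d)) : ℝ :=
  ∑ i : Fin d, (fderiv ℝ F x (EuclideanSpace.single i 1)) i

/-- Laplacian of a scalar function on `ℝ^d`: the divergence of its gradient,
i.e. the sum of its second partial derivatives. -/
noncomputable def laplacian' {d : ℕ}
    (ρ : EuclideanSpace ℝ (Fin d) → ℝ) (x : EuclideanSpace ℝ (Fin d)) : ℝ :=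
  diverg (fun y => gradient ρ y) x

theorem diverg_add {d : ℕ} {F G : EuclideanSpace ℝ (Fin d) → EuclideanSpace ℝ (Fin d)}
    {x : EuclideanSpace ℝ (Fin d)} (hF : DifferentiableAt ℝ F x) (hG : DifferentiableAt ℝ G x) :
    diverg (fun y => F y + G y) x = diverg F x + diverg G x := by
  simp [diverg, fderiv_fun_add hF hG, Finset.sum_add_distrib]

theorem diverg_const_smul {d : ℕ} {F : EuclideanSpace ℝ (Fin d) → EuclideanSpace ℝ (Fin d)}
    {x : EuclideanSpace ℝ (Fin d)} (hF : DifferentiableAt ℝ F x) (c : ℝ) :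
    diverg (fun y => c • F y) x = c * diverg F x := by
  simp [diverg, fderiv_fun_const_smul hF, Finset.mul_sum]

theorem smul_gradient_log_comp_s11 {E : Type*} [NormedAddCommGroup E] [InnerProductSpace ℝ E]
    [CompleteSpace E] {p : E → ℝ} {x : E} (hp : DifferentiableAt ℝ p x) (hx : p x ≠ 0) :
    p x • gradient (Real.log ∘ p) x = gradient p x := by
  have h : fderiv ℝ (Real.log ∘ p) x = (p x)⁻¹ • fderiv ℝ p x := fderiv.log hp hx
  simp [gradient, h, smul_smul, hx]

theorem ContDiff.differentiable_gradient {E : Type*} [NormedAddCommGroup E]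
    [InnerProductSpace ℝ E] [CompleteSpace E] {p : E → ℝ} (hp : ContDiff ℝ 2 p) :
    Differentiable ℝ (gradient p) :=
  (InnerProductSpace.toDual ℝ E).symm.toContinuousLinearEquiv.differentiable.comp
    ((hp.fderiv_right (m := 1) (by norm_num)).differentiable one_ne_zero)

/-- **Continuity equation implies Fokker–Planck with score-corrected drift.**
Let `ρ : (0,1) × ℝ^d → ℝ` be strictly positive, `C¹` in time and `C²` in space, and
`v : (0,1) × ℝ^d → ℝ^d` be `C¹` in space. If `ρ` satisfies the continuity equation
`∂_t ρ = −div(v·ρ)`, then for every `σ : (0,1) → ℝ`, the drift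
`f(t,x) = v(t,x) + (σ(t)²/2)·∇log ρ(t,x)` satisfies the Fokker–Planck equation
`∂_t ρ = −div(f·ρ) + (σ(t)²/2)·Δρ` on `(0,1) × ℝ^d`. -/
theorem continuity_eq_implies_fokker_planck_score_drift
    {d : ℕ} (hd : 1 ≤ d)
    (ρ : ℝ → EuclideanSpace ℝ (Fin d) → ℝ)
    (v : ℝ → EuclideanSpace ℝ (Fin d) → EuclideanSpace ℝ (Fin d))
    (hρ_pos : ∀ t ∈ Ioo (0 : ℝ) 1, ∀ x, 0 < ρ t x)
    (hρ_time : ∀ x, ContDiffOn ℝ 1 (fun t => ρ t x) (Ioo (0 : ℝ) 1))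
    (hρ_space : ∀ t ∈ Ioo (0 : ℝ) 1, ContDiff ℝ 2 (ρ t))
    (hv_space : ∀ t ∈ Ioo (0 : ℝ) 1, ContDiff ℝ 1 (v t))
    (hcont : ∀ t ∈ Ioo (0 : ℝ) 1, ∀ x,
      deriv (fun τ => ρ τ x) t = -diverg (fun y => ρ t y • v t y) x) :
    ∀ σ : ℝ → ℝ,
      ∀ f : ℝ → EuclideanSpace ℝ (Fin d) → EuclideanSpace ℝ (Fin d),
        (f = fun t x => v t x + (σ t ^ 2 / 2) • gradient (Real.log ∘ ρ t) x) →
        ∀ t ∈ Ioo (0 : ℝ) 1, ∀ x,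
          deriv (fun τ => ρ τ x) t
            = -diverg (fun y => ρ t y • f t y) x + σ t ^ 2 / 2 * laplacian' (ρ t) x := by
  rintro σ _ rfl t ht x
  have hρ : Differentiable ℝ (ρ t) := (hρ_space t ht).differentiable two_ne_zero
  have hv : Differentiable ℝ (v t) := (hv_space t ht).differentiable one_ne_zero
  have hgrad : Differentiable ℝ (gradient (ρ t)) := (hρ_space t ht).differentiable_gradient
  have hflux : (fun y => ρ t y • (v t y + (σ t ^ 2 / 2) • gradient (Real.log ∘ ρ t) y))
      = fun y => ρ t y • v t y + (σ t ^ 2 / 2) • gradient (ρ t) y := by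
    funext y
    rw [smul_add, smul_comm, smul_gradient_log_comp_s11 (hρ y) (hρ_pos t ht y).ne']
  rw [hcont t ht x, hflux, diverg_add ((hρ x).fun_smul (hv x)) ((hgrad x).fun_const_smul _),
    diverg_const_smul (hgrad x), laplacian']
  ring
end
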